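/- Let n ∈ ℕ with n ≥ 36, let ε ≤ 1/4, and set Δ := 10^{−5}, c := 0.999, λ₀ := 1/2 + 1/(2√2). If f : {0,1}^n × {0,1}^n → {0,1} is drawn uniformly at random from F*_ε (case m = 1), then with probability at least 1 − 2^{−2^{n − c·log₂(1/(λ₀+Δ))}} the function f has the following property: for every q ∈ ℕ with q < n/2 + (1/2)·log₂( (λ₀+Δ)^c · (1−(λ₀+Δ)^{1−c}) · log₂((λ₀+Δ)/λ₀) / (8·log₂(1/Δ)) ), every q-qubit strategy S for QPV_BB84^f (the case m = 1 with γ = 0) satisfies ω_S ≤ (1/2 + 1/(2√2) + 10^{−5})^{0.999} · (1 + 3·√(6·ln 2)·2^{−n}) + 21·10^{−5}. -/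

import Mathlib

open Matrix Kronecker Finset
open scoped ComplexOrder

noncomputable section

/-- Bit strings of length `n`. -/
abbrev Bits (n : ℕ) := Fin n → Bool

/-- Binary entropy function `h(p) = -p log₂ p - (1-p) log₂ (1-p)` (with `h 0 = 0`). -/
def binEnt (p : ℝ) : ℝ := -(p * Real.logb 2 p) - (1 - p) * Real.logb 2 (1 - p)

/-- `λ_γ = 2^{h(γ)} (1/2 + 1/(2√2))`. -/
def lamGamma (γ : ℝ) : ℝ := (2 : ℝ) ^ binEnt γ * (1 / 2 + 1 / (2 * Real.sqrt 2))

/-- Standard basis vector `|a⟩` of `ℂ²`. -/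
def ket (a : Bool) : Bool → ℂ := fun j => if j = a then 1 else 0

/-- The vector `H^z |a⟩` of `ℂ²`, where `H` is the 2×2 Hadamard matrix. -/
def hadVec (z a : Bool) : Bool → ℂ :=
  if z then fun j => (if j && a then (-1 : ℂ) else 1) / (Real.sqrt 2 : ℂ) else ket a

/-- The unit vector `⊗_{i} H^{z_i}|a_i⟩` of `(ℂ²)^{⊗ m}`. -/
def bb84Vec {m : ℕ} (z a : Bits m) : Bits m → ℂ := fun j => ∏ i, hadVec (z i) (a i) (j i)

/-- `M^z_a`: the rank-one orthogonal projector onto `⊗_i H^{z_i}|a_i⟩`. -/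
def Mproj {m : ℕ} (z a : Bits m) : Matrix (Bits m) (Bits m) ℂ :=
  vecMulVec (bb84Vec z a) (star (bb84Vec z a))

/-- A POVM: a family of positive semidefinite matrices summing to the identity. -/
def IsPOVM {d : Type*} [Fintype d] [DecidableEq d] {ι : Type*} [Fintype ι]
    (A : ι → Matrix d d ℂ) : Prop :=
  (∀ a, (A a).PosSemidef) ∧ ∑ a, A a = 1

/-- `q_f(z)`: the fraction of input pairs `(x,y)` mapped by `f` to `z`. -/
def qf (n m : ℕ) (f : Bits n × Bits n → Bits m) (z : Bits m) : ℝ :=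
  ((Finset.univ.filter (fun p : Bits n × Bits n => f p = z)).card : ℝ) / 2 ^ (2 * n)

/-- The set `F*_ε` of functions whose output distribution is close to uniform. -/
def Fstar (n m : ℕ) (ε : ℝ) : Set (Bits n × Bits n → Bits m) :=
  {f | ∀ z : Bits m,
    |qf n m f z - (2 : ℝ) ^ (-(m : ℝ))| ≤
      Real.sqrt (3 * Real.log (2 / ε)) * (2 : ℝ) ^ (-(n : ℝ) - m / 2)}

/-- A `q`-qubit strategy for `QPV_BB84^{f:n→m}`: a splitting of `q` qubits on each side
into kept/communicated registers, a shared state `φ`, local unitaries `U^x`, `V^y`, and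
response POVMs `A^{xy}`, `B^{xy}` on the regrouped registers. -/
structure BB84Strategy (n m q : ℕ) where
  qAk : ℕ
  qAc : ℕ
  qBk : ℕ
  qBc : ℕ
  hqA : qAk + qAc = q
  hqB : qBk + qBc = q
  φ : Bits m × (Bits qAk × Bits qAc) × (Bits qBk × Bits qBc) → ℂ
  hφ : ∑ i, ‖φ i‖ ^ 2 = 1
  U : Bits n → Matrix (Bits qAk × Bits qAc) (Bits qAk × Bits qAc) ℂ
  V : Bits n → Matrix (Bits qBk × Bits qBc) (Bits qBk × Bits qBc) ℂ
  hU : ∀ x, U x ∈ Matrix.unitaryGroup (Bits qAk × Bits qAc) ℂ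
  hV : ∀ y, V y ∈ Matrix.unitaryGroup (Bits qBk × Bits qBc) ℂ
  A : Bits n → Bits n → Bits m → Matrix (Bits qAk × Bits qBc) (Bits qAk × Bits qBc) ℂ
  B : Bits n → Bits n → Bits m → Matrix (Bits qBk × Bits qAc) (Bits qBk × Bits qAc) ℂ
  hA : ∀ x y, IsPOVM (A x y)
  hB : ∀ x y, IsPOVM (B x y)

/-- The state `ψ_{xy} = (I ⊗ U^x ⊗ V^y)φ`, viewed in `V ⊗ A' ⊗ B'` via the canonical
reordering of tensor factors (`A' = A_k ⊗ B_c`, `B' = B_k ⊗ A_c`). -/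
def BB84Strategy.psi {n m q : ℕ} (S : BB84Strategy n m q) (x y : Bits n) :
    Bits m × (Bits S.qAk × Bits S.qBc) × (Bits S.qBk × Bits S.qAc) → ℂ :=
  fun u =>
    (((1 : Matrix (Bits m) (Bits m) ℂ) ⊗ₖ (S.U x ⊗ₖ S.V y)).mulVec S.φ)
      (u.1, (u.2.1.1, u.2.2.2), (u.2.2.1, u.2.1.2))

/-- The winning probability `ω_S` of a strategy, with error tolerance `γ`. -/
def BB84Strategy.win {n m q : ℕ} (S : BB84Strategy n m q) (γ : ℝ)
    (f : Bits n × Bits n → Bits m) : ℝ :=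
  (1 / 2 ^ (2 * n) : ℝ) * ∑ x : Bits n, ∑ y : Bits n, ∑ a : Bits m,
    (star (S.psi x y) ⬝ᵥ ((Mproj (f (x, y)) a ⊗ₖ
        (∑ a' ∈ Finset.univ.filter
            (fun a' : Bits m => (hammingDist a a' : ℝ) ≤ γ * m),
          S.A x y a' ⊗ₖ S.B x y a')).mulVec (S.psi x y))).re

section Covering

open MeasureTheory Metric
open scoped ENNReal

/-- A set of points of the unit ball at mutual distance `> 2 r` has at most `(1 + 1 / r) ^ dim`
elements. -/
lemma card_le_of_separated_unitBall {E : Type*} [NormedAddCommGroup E] [NormedSpace ℝ E]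
    [FiniteDimensional ℝ E] {r : ℝ} (hr : 0 < r) (s : Finset E) (hs : ∀ c ∈ s, ‖c‖ ≤ 1)
    (h : ∀ c ∈ s, ∀ d ∈ s, c ≠ d → 2 * r ≤ ‖c - d‖) :
    (s.card : ℝ) ≤ (1 + 1 / r) ^ Module.finrank ℝ E := by
  borelize E
  let μ : Measure E := Measure.addHaar
  have hρ : 0 < 1 + r := by positivity
  have hdisj : Set.Pairwise (s : Set E) (Function.onFun Disjoint fun c => ball (c : E) r) := by
    rintro c hc d hd hcd
    apply ball_disjoint_ball
    rw [dist_eq_norm, ← two_mul]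
    exact h c hc d hd hcd
  have hsub : (⋃ c ∈ s, ball (c : E) r) ⊆ ball (0 : E) (1 + r) := by
    refine Set.iUnion₂_subset fun x hx => ball_subset_ball' ?_
    rw [dist_zero_right]
    linarith [hs x hx]
  have hvol : (s.card : ℝ≥0∞) * ENNReal.ofReal (r ^ Module.finrank ℝ E) * μ (ball 0 1) ≤
      ENNReal.ofReal ((1 + r) ^ Module.finrank ℝ E) * μ (ball 0 1) :=
    calc
      _ = μ (⋃ c ∈ s, ball (c : E) r) := by
        rw [measure_biUnion_finset hdisj fun c _ => measurableSet_ball]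
        simp only [μ.addHaar_ball_of_pos _ hr, Finset.sum_const, nsmul_eq_mul, mul_assoc]
      _ ≤ μ (ball (0 : E) (1 + r)) := measure_mono hsub
      _ = _ := by simp only [μ.addHaar_ball_of_pos _ hρ]
  have hcancel := (ENNReal.mul_le_mul_iff_left (measure_ball_pos _ _ zero_lt_one).ne'
    measure_ball_lt_top.ne).1 hvol
  have hreal := ENNReal.toReal_le_of_le_ofReal (pow_nonneg hρ.le _) hcancel
  rw [ENNReal.toReal_mul, ENNReal.toReal_natCast,
    ENNReal.toReal_ofReal (pow_nonneg hr.le _)] at hreal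
  have heq : 1 + 1 / r = (1 + r) / r := by field_simp; ring
  rw [heq, div_pow, le_div_iff₀ (pow_pos hr _)]
  exact hreal

/-- The unit ball can be partitioned into `2 ^ ((k + 3) * dim)` cells of diameter at most
`(1 / 2) ^ k`. -/
lemma exists_cell_map (E : Type*) [NormedAddCommGroup E] [NormedSpace ℝ E]
    [FiniteDimensional ℝ E] (k : ℕ) :
    ∃ cell : E → Fin (2 ^ ((k + 3) * Module.finrank ℝ E)),
      ∀ u v : E, ‖u‖ ≤ 1 → ‖v‖ ≤ 1 → cell u = cell v → ‖u - v‖ ≤ (1 / 2) ^ k := by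
  classical
  set r : ℝ := (1 / 2) ^ k / 4 with hr
  have hr0 : 0 < r := by positivity
  let P : Finset E → Prop := fun s =>
    (∀ c ∈ s, ‖c‖ ≤ 1) ∧ ∀ c ∈ s, ∀ d ∈ s, c ≠ d → 2 * r ≤ ‖c - d‖
  have hcard : ∀ s, P s → s.card ≤ 2 ^ ((k + 3) * Module.finrank ℝ E) := by
    intro s hs
    have h1 := card_le_of_separated_unitBall hr0 s hs.1 hs.2
    have h2 : 1 + 1 / r ≤ 2 ^ (k + 3) := by
      have h3 : 1 / r = 4 * 2 ^ k := by rw [hr, _root_.one_div_pow]; field_simp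
      have h4 : (1 : ℝ) ≤ 2 ^ k := one_le_pow₀ (by norm_num)
      rw [h3, pow_add]
      linarith
    have h5 : (s.card : ℝ) ≤ 2 ^ ((k + 3) * Module.finrank ℝ E) := by
      rw [pow_mul]
      exact h1.trans (pow_le_pow_left₀ (by positivity) h2 _)
    exact_mod_cast h5
  let C : Set ℕ := {m | ∃ s, P s ∧ s.card = m}
  have hC : BddAbove C := ⟨_, by rintro m ⟨s, hs, rfl⟩; exact hcard s hs⟩
  have hCne : C.Nonempty := ⟨0, ∅, by simp [P], rfl⟩
  obtain ⟨s, hs, hsC⟩ := Nat.sSup_mem hCne hC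
  have hcover : ∀ u : E, ‖u‖ ≤ 1 → ∃ c ∈ s, ‖u - c‖ ≤ 2 * r := by
    intro u hu
    by_contra! hcon
    have hus : u ∉ s := fun hmem => by
      have := hcon u hmem
      simp at this
      linarith
    have hP : P (insert u s) := by
      refine ⟨?_, ?_⟩
      · intro c hc
        rcases Finset.mem_insert.1 hc with rfl | hc
        exacts [hu, hs.1 c hc]
      · intro c hc d hd hcd
        rcases Finset.mem_insert.1 hc with hcu | hcs <;>
          rcases Finset.mem_insert.1 hd with hdu | hds
        · exact absurd (hcu.trans hdu.symm) hcd
        · rw [hcu]; exact (hcon d hds).le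
        · rw [hdu, norm_sub_rev]; exact (hcon c hcs).le
        · exact hs.2 c hcs d hds hcd
    have hle := le_csSup hC ⟨_, hP, rfl⟩
    rw [Finset.card_insert_of_notMem hus, hsC] at hle
    omega
  have : ∀ u : E, ∃ i : Fin (2 ^ ((k + 3) * Module.finrank ℝ E)),
      ‖u‖ ≤ 1 → ∃ c : s, ‖u - c‖ ≤ 2 * r ∧ Fin.castLE (hcard s hs) (s.equivFin c) = i := by
    intro u
    by_cases hu : ‖u‖ ≤ 1
    · obtain ⟨c, hc, hcu⟩ := hcover u hu
      exact ⟨_, fun _ => ⟨⟨c, hc⟩, hcu, rfl⟩⟩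
    · exact ⟨⟨0, by positivity⟩, fun h => absurd h hu⟩
  choose cell hcell using this
  refine ⟨cell, fun u v hu hv huv => ?_⟩
  obtain ⟨c, hc, hci⟩ := hcell u hu
  obtain ⟨d, hd, hdi⟩ := hcell v hv
  have hcd : c = d := s.equivFin.injective (Fin.castLE_injective _ (hci.trans (huv.trans hdi.symm)))
  subst hcd
  calc ‖u - v‖ = ‖(u - c) - (v - c)‖ := by congr 1; abel
    _ ≤ ‖u - c‖ + ‖v - c‖ := norm_sub_le _ _
    _ ≤ 2 * r + 2 * r := add_le_add hc hd
    _ = (1 / 2) ^ k := by rw [hr]; ring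

end Covering

section Concentration

/-- Hoeffding's inequality for a uniformly random function into a two-element set, stated as a
count of functions. -/
lemma ncard_le_sum_le {P : Type*} [Fintype P] [DecidableEq P] {Z : Type*} [Fintype Z]
    [DecidableEq Z] (hZ : Fintype.card Z = 2) (v : Z → P → ℝ) (hv0 : ∀ z p, 0 ≤ v z p)
    (hv1 : ∀ z p, v z p ≤ 1) {l : ℝ} (hl : ∀ p, ∑ z, v z p ≤ 2 * l) {t : ℝ} (ht : 0 ≤ t) :
    ({f : P → Z | (l + t) * Fintype.card P ≤ ∑ p, v (f p) p}.ncard : ℝ) ≤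
      2 ^ Fintype.card P * Real.exp (-(2 * t ^ 2 * Fintype.card P)) := by
  have hfactor : ∀ p, ∑ z, Real.exp (4 * t * (v z p - (l + t))) ≤ 2 * Real.exp (-(2 * t ^ 2)) := by
    intro p
    obtain ⟨z₀, z₁, hne, huniv⟩ := Finset.card_eq_two.1 (by rwa [← Finset.card_univ] at hZ)
    have hlp := hl p
    rw [huniv, Finset.sum_pair hne] at hlp ⊢
    set a := v z₀ p
    set b := v z₁ p
    have hab : (a - b) ^ 2 ≤ 1 := by
      have := hv0 z₀ p; have := hv1 z₀ p; have := hv0 z₁ p; have := hv1 z₁ p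
      rw [sq_le_one_iff_abs_le_one, abs_le]
      constructor <;> linarith
    have hcosh := Real.cosh_le_exp_half_sq (2 * t * (a - b))
    rw [Real.cosh_eq] at hcosh
    calc Real.exp (4 * t * (a - (l + t))) + Real.exp (4 * t * (b - (l + t)))
        = 2 * (Real.exp (2 * t * (a + b - 2 * l) - 4 * t ^ 2) *
            ((Real.exp (2 * t * (a - b)) + Real.exp (-(2 * t * (a - b)))) / 2)) := by
          rw [mul_div_assoc', mul_add, ← Real.exp_add, ← Real.exp_add,
            mul_div_cancel₀ _ (two_ne_zero)]
          congr 2 <;> ring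
      _ ≤ 2 * (Real.exp (2 * t * (a + b - 2 * l) - 4 * t ^ 2) *
            Real.exp ((2 * t * (a - b)) ^ 2 / 2)) := by gcongr
      _ ≤ 2 * Real.exp (-(2 * t ^ 2)) := by
          rw [← Real.exp_add]
          gcongr
          nlinarith [mul_nonneg ht (sub_nonneg.2 hlp), mul_nonneg (sq_nonneg t) (sub_nonneg.2 hab)]
  rw [Set.ncard_eq_toFinset_card', Set.toFinset_ofPred]
  calc (((Finset.univ : Finset (P → Z)).filter
        (fun f => (l + t) * Fintype.card P ≤ ∑ p, v (f p) p)).card : ℝ)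
      ≤ ∑ f : P → Z, ∏ p, Real.exp (4 * t * (v (f p) p - (l + t))) := by
        rw [← nsmul_one, ← Finset.sum_const]
        refine (Finset.sum_le_sum fun f hf => ?_).trans
          (Finset.sum_le_sum_of_subset_of_nonneg (Finset.filter_subset _ _)
            fun f _ _ => by positivity)
        rw [← Real.exp_sum, Real.one_le_exp_iff, ← Finset.mul_sum, Finset.sum_sub_distrib,
          Finset.sum_const, nsmul_eq_mul, Finset.card_univ]
        have := (Finset.mem_filter.1 hf).2
        exact mul_nonneg (by positivity) (by linarith)
    _ = ∏ p, ∑ z, Real.exp (4 * t * (v z p - (l + t))) := by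
        rw [Finset.prod_univ_sum, Fintype.piFinset_univ]
    _ ≤ ∏ _p : P, 2 * Real.exp (-(2 * t ^ 2)) :=
        Finset.prod_le_prod (fun p _ => by positivity) fun p _ => hfactor p
    _ = _ := by
        rw [Finset.prod_const, Finset.card_univ, mul_pow, ← Real.exp_nat_mul]
        congr 2
        ring

end Concentration

section OperatorNorm

open scoped Matrix.Norms.L2Operator MatrixOrder

lemma l2_opNorm_le_of_mulVec_le {ι κ : Type*} [Fintype ι] [Fintype κ] [DecidableEq ι]
    [DecidableEq κ] (A : Matrix ι κ ℂ) {c : ℝ} (hc : 0 ≤ c)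
    (h : ∀ v : κ → ℂ, ∑ i, ‖(A *ᵥ v) i‖ ^ 2 ≤ c ^ 2 * ∑ i, ‖v i‖ ^ 2) : ‖A‖ ≤ c := by
  rw [Matrix.l2_opNorm_def]
  refine ContinuousLinearMap.opNorm_le_bound _ hc fun v => ?_
  refine le_of_sq_le_sq ?_ (by positivity)
  rw [mul_pow, EuclideanSpace.norm_sq_eq, EuclideanSpace.norm_sq_eq]
  exact h v

lemma sum_norm_sq_mulVec_le {ι κ : Type*} [Fintype ι] [Fintype κ] [DecidableEq ι]
    [DecidableEq κ] (A : Matrix ι κ ℂ) (v : κ → ℂ) :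
    ∑ i, ‖(A *ᵥ v) i‖ ^ 2 ≤ ‖A‖ ^ 2 * ∑ i, ‖v i‖ ^ 2 := by
  have h := pow_le_pow_left₀ (norm_nonneg _) (A.l2_opNorm_mulVec (WithLp.toLp 2 v)) 2
  rw [mul_pow, EuclideanSpace.norm_sq_eq, EuclideanSpace.norm_sq_eq] at h
  exact h

lemma l2_opNorm_one_kronecker_le {ι κ : Type*} [Fintype ι] [Fintype κ] [DecidableEq ι]
    [DecidableEq κ] (A : Matrix κ κ ℂ) : ‖(1 : Matrix ι ι ℂ) ⊗ₖ A‖ ≤ ‖A‖ := by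
  refine l2_opNorm_le_of_mulVec_le _ (norm_nonneg _) fun v => ?_
  have hslice : ∀ i j, (((1 : Matrix ι ι ℂ) ⊗ₖ A) *ᵥ v) (i, j) = (A *ᵥ fun k => v (i, k)) j := by
    intro i j
    simp [Matrix.mulVec, dotProduct, Fintype.sum_prod_type, Matrix.one_apply, ite_mul]
  rw [Fintype.sum_prod_type, Fintype.sum_prod_type, Finset.mul_sum]
  refine Finset.sum_le_sum fun i _ => ?_
  simp only [hslice]
  exact sum_norm_sq_mulVec_le A _

lemma l2_opNorm_kronecker_one_le {ι κ : Type*} [Fintype ι] [Fintype κ] [DecidableEq ι]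
    [DecidableEq κ] (A : Matrix κ κ ℂ) : ‖A ⊗ₖ (1 : Matrix ι ι ℂ)‖ ≤ ‖A‖ := by
  refine l2_opNorm_le_of_mulVec_le _ (norm_nonneg _) fun v => ?_
  have hslice : ∀ j i, ((A ⊗ₖ (1 : Matrix ι ι ℂ)) *ᵥ v) (j, i) = (A *ᵥ fun k => v (k, i)) j := by
    intro j i
    simp [Matrix.mulVec, dotProduct, Fintype.sum_prod_type, Matrix.one_apply]
  rw [Fintype.sum_prod_type_right, Fintype.sum_prod_type_right, Finset.mul_sum]
  refine Finset.sum_le_sum fun i _ => ?_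
  simp only [hslice]
  exact sum_norm_sq_mulVec_le A _

lemma l2_opNorm_kronecker_le {ι κ : Type*} [Fintype ι] [Fintype κ] [DecidableEq ι]
    [DecidableEq κ] (A : Matrix ι ι ℂ) (B : Matrix κ κ ℂ) : ‖A ⊗ₖ B‖ ≤ ‖A‖ * ‖B‖ := by
  have h : A ⊗ₖ B = (A ⊗ₖ (1 : Matrix κ κ ℂ)) * ((1 : Matrix ι ι ℂ) ⊗ₖ B) := by
    rw [← Matrix.mul_kronecker_mul, Matrix.mul_one, Matrix.one_mul]
  rw [h]
  exact (Matrix.l2_opNorm_mul _ _).trans (mul_le_mul (l2_opNorm_kronecker_one_le A)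
    (l2_opNorm_one_kronecker_le B) (norm_nonneg _) (norm_nonneg _))

lemma star_dotProduct_self {ι : Type*} [Fintype ι] (v : ι → ℂ) :
    star v ⬝ᵥ v = ((∑ i, ‖v i‖ ^ 2 : ℝ) : ℂ) := by
  simp only [dotProduct, Pi.star_apply, Complex.ofReal_sum, RCLike.star_def, Complex.conj_mul']
  push_cast
  rfl

lemma star_dotProduct_conjTranspose_mul_self {ι : Type*} [Fintype ι] (C : Matrix ι ι ℂ)
    (v : ι → ℂ) : star v ⬝ᵥ ((Cᴴ * C) *ᵥ v) = ((∑ i, ‖(C *ᵥ v) i‖ ^ 2 : ℝ) : ℂ) := by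
  rw [← star_dotProduct_self, Matrix.star_mulVec, ← Matrix.dotProduct_mulVec, Matrix.mulVec_mulVec]

lemma l2_opNorm_le_one {ι : Type*} [Fintype ι] [DecidableEq ι] {C : Matrix ι ι ℂ}
    (h : (1 - Cᴴ * C).PosSemidef) : ‖C‖ ≤ 1 := by
  refine l2_opNorm_le_of_mulVec_le _ zero_le_one fun v => ?_
  have := h.dotProduct_mulVec_nonneg v
  rw [Matrix.sub_mulVec, Matrix.one_mulVec, dotProduct_sub, star_dotProduct_self,
    star_dotProduct_conjTranspose_mul_self, sub_nonneg] at this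
  rw [one_pow, one_mul]
  exact_mod_cast this

lemma re_dotProduct_mulVec_le {ι : Type*} [Fintype ι] [DecidableEq ι] (C : Matrix ι ι ℂ)
    (v : ι → ℂ) (hv : ∑ i, ‖v i‖ ^ 2 = 1) : (star v ⬝ᵥ (C *ᵥ v)).re ≤ ‖C‖ := by
  have hn : ‖WithLp.toLp 2 v‖ = 1 := by
    rw [← sq_eq_sq₀ (norm_nonneg _) zero_le_one, EuclideanSpace.norm_sq_eq, one_pow]
    exact hv
  have h1 := re_inner_le_norm (𝕜 := ℂ) (WithLp.toLp 2 v) (WithLp.toLp 2 (C *ᵥ v))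
  rw [EuclideanSpace.inner_toLp_toLp, hn, one_mul, dotProduct_comm] at h1
  refine h1.trans ?_
  have h2 := C.l2_opNorm_mulVec (WithLp.toLp 2 v)
  rw [hn, mul_one] at h2
  exact h2

/-- A quadratic form between `0` and the identity changes by at most twice the distance of the
arguments. -/
lemma re_dotProduct_mulVec_sub_le {ι : Type*} [Fintype ι] [DecidableEq ι] {G : Matrix ι ι ℂ}
    (hG : G.PosSemidef) (hG1 : (1 - G).PosSemidef) (v w : ι → ℂ) (hv : ∑ i, ‖v i‖ ^ 2 = 1)
    (hw : ∑ i, ‖w i‖ ^ 2 = 1) :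
    (star v ⬝ᵥ (G *ᵥ v)).re ≤ (star w ⬝ᵥ (G *ᵥ w)).re + 2 * ‖WithLp.toLp 2 (v - w)‖ := by
  obtain ⟨C, rfl⟩ : ∃ C : Matrix ι ι ℂ, G = Cᴴ * C :=
    CStarAlgebra.nonneg_iff_eq_star_mul_self.mp hG.nonneg
  have hC := l2_opNorm_le_one hG1
  have hnorm : ∀ u : ι → ℂ, (star u ⬝ᵥ ((Cᴴ * C) *ᵥ u)).re = ‖WithLp.toLp 2 (C *ᵥ u)‖ ^ 2 := by
    intro u
    rw [star_dotProduct_conjTranspose_mul_self, EuclideanSpace.norm_sq_eq, Complex.ofReal_re]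
  have hle : ∀ u : ι → ℂ, ‖WithLp.toLp 2 (C *ᵥ u)‖ ≤ ‖WithLp.toLp 2 u‖ := fun u =>
    (C.l2_opNorm_mulVec (WithLp.toLp 2 u)).trans (mul_le_of_le_one_left (norm_nonneg _) hC)
  have hone : ∀ u : ι → ℂ, ∑ i, ‖u i‖ ^ 2 = 1 → ‖WithLp.toLp 2 u‖ = 1 := by
    intro u hu
    rw [← sq_eq_sq₀ (norm_nonneg _) zero_le_one, EuclideanSpace.norm_sq_eq, one_pow]
    exact hu
  rw [hnorm, hnorm]
  have h1 := hle v
  have h2 := hle w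
  rw [hone v hv] at h1
  rw [hone w hw] at h2
  have h3 : ‖WithLp.toLp 2 (C *ᵥ v)‖ - ‖WithLp.toLp 2 (C *ᵥ w)‖ ≤ ‖WithLp.toLp 2 (v - w)‖ := by
    refine (norm_sub_norm_le _ _).trans ?_
    rw [← WithLp.toLp_sub, ← Matrix.mulVec_sub]
    exact hle _
  nlinarith [norm_nonneg (WithLp.toLp 2 (C *ᵥ v)), norm_nonneg (WithLp.toLp 2 (C *ᵥ w)),
    norm_nonneg (WithLp.toLp 2 (v - w))]

end OperatorNorm

section MonogamyGame

open scoped Matrix.Norms.L2Operator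

/-- The operator measuring the probability that both players guess the outcome of a measurement of
the first register in basis `z`. -/
def guessOp {α β : Type*} (z : Bits 1) (A : Bits 1 → Matrix α α ℂ) (B : Bits 1 → Matrix β β ℂ) :
    Matrix (Bits 1 × α × β) (Bits 1 × α × β) ℂ :=
  ∑ a, Mproj z a ⊗ₖ (A a ⊗ₖ B a)

lemma sum_bits_one {M : Type*} [AddCommMonoid M] (F : Bits 1 → M) :
    ∑ a, F a = F (fun _ => true) + F (fun _ => false) := by
  rw [← Equiv.sum_comp (Equiv.funUnique (Fin 1) Bool).symm F, Fintype.sum_bool]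
  rfl

lemma bits_one_eq (z : Bits 1) : z = fun _ => z 0 := by
  ext i
  rw [Subsingleton.elim i 0]

/-- The observable associated with the measurement in basis `z`. -/
def pauli (z : Bits 1) : Matrix (Bits 1) (Bits 1) ℂ :=
  Mproj z (fun _ => true) - Mproj z (fun _ => false)

lemma Mproj_one_apply (z a i j : Bits 1) :
    Mproj z a i j = hadVec (z 0) (a 0) (i 0) * star (hadVec (z 0) (a 0) (j 0)) := by
  simp [Mproj, bb84Vec, vecMulVec_apply]

lemma ofReal_sqrt_two_mul_self : (Real.sqrt 2 : ℂ) * (Real.sqrt 2 : ℂ) = 2 := by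
  rw [← Complex.ofReal_mul, Real.mul_self_sqrt (by norm_num)]
  norm_num

lemma inv_ofReal_sqrt_two_mul_self : (Real.sqrt 2 : ℂ)⁻¹ * (Real.sqrt 2 : ℂ)⁻¹ = 1 / 2 := by
  rw [← mul_inv, ofReal_sqrt_two_mul_self, one_div]

lemma sum_Mproj_one (z : Bits 1) : ∑ a, Mproj z a = 1 := by
  rw [sum_bits_one]
  ext i j
  rw [Matrix.add_apply, Mproj_one_apply, Mproj_one_apply, Matrix.one_apply]
  rw [bits_one_eq i, bits_one_eq j]
  have h := inv_ofReal_sqrt_two_mul_self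
  cases z 0 <;> cases i 0 <;> cases j 0 <;>
    simp [hadVec, ket, funext_iff, div_eq_mul_inv, h] <;> norm_num

lemma Mproj_posSemidef {m : ℕ} (z a : Bits m) : (Mproj z a).PosSemidef :=
  Matrix.posSemidef_vecMulVec_self_star _

lemma pauli_isHermitian (z : Bits 1) : (pauli z).IsHermitian :=
  (Mproj_posSemidef _ _).isHermitian.sub (Mproj_posSemidef _ _).isHermitian

lemma pauli_apply (z i j : Bits 1) : pauli z i j =
    if z 0 then (if i 0 = j 0 then 0 else -1) else
      (if i 0 = j 0 then (if i 0 then 1 else -1) else 0) := by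
  rw [pauli, Matrix.sub_apply, Mproj_one_apply, Mproj_one_apply]
  have h := inv_ofReal_sqrt_two_mul_self
  cases z 0 <;> cases i 0 <;> cases j 0 <;>
    simp [hadVec, ket, div_eq_mul_inv, h] <;> norm_num

lemma pauli_mul_self (z : Bits 1) : pauli z * pauli z = 1 := by
  ext i j
  rw [Matrix.mul_apply, sum_bits_one, Matrix.one_apply]
  simp only [pauli_apply]
  rw [bits_one_eq i, bits_one_eq j]
  cases z 0 <;> cases i 0 <;> cases j 0 <;> simp [funext_iff]

lemma pauli_anticomm :
    pauli (fun _ => true) * pauli (fun _ => false) +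
      pauli (fun _ => false) * pauli (fun _ => true) = 0 := by
  ext i j
  simp only [Matrix.add_apply, Matrix.mul_apply, sum_bits_one, pauli_apply]
  cases i 0 <;> cases j 0 <;> simp

lemma norm_pauli_le (z : Bits 1) : ‖pauli z‖ ≤ 1 := by
  refine l2_opNorm_le_one ?_
  rw [(pauli_isHermitian z).eq, pauli_mul_self, sub_self]
  exact .zero

lemma IsPOVM.one_sub_posSemidef {d ι : Type*} [Fintype d] [DecidableEq d] [Fintype ι]
    [DecidableEq ι] {A : ι → Matrix d d ℂ} (hA : IsPOVM A) (a : ι) : (1 - A a).PosSemidef := by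
  rw [← hA.2, ← Finset.add_sum_erase _ _ (Finset.mem_univ a), add_sub_cancel_left]
  exact Matrix.posSemidef_sum _ fun i _ => hA.1 i

lemma IsPOVM.norm_sub_le {d : Type*} [Fintype d] [DecidableEq d] {A : Bits 1 → Matrix d d ℂ}
    (hA : IsPOVM A) : ‖A (fun _ => true) - A (fun _ => false)‖ ≤ 1 := by
  have hsum := hA.2
  rw [sum_bits_one] at hsum
  set P := A (fun _ => true)
  set Q := A (fun _ => false)
  have hP : P.PosSemidef := hA.1 _
  have hQ : Q.PosSemidef := hA.1 _
  have hPQ : Q = 1 - P := by rw [← hsum]; abel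
  refine l2_opNorm_le_one ?_
  have h : 1 - (P - Q)ᴴ * (P - Q) = 4 • (Pᴴ * Q * P + Qᴴ * P * Q) := by
    rw [(hP.isHermitian.sub hQ.isHermitian).eq, hP.isHermitian.eq, hQ.isHermitian.eq, hPQ]
    noncomm_ring
  rw [h]
  exact ((hQ.conjTranspose_mul_mul_same P).add (hP.conjTranspose_mul_mul_same Q)).smul
    (by norm_num)

lemma sub_kronecker {α β : Type*} (A A' : Matrix α α ℂ) (B : Matrix β β ℂ) :
    (A - A') ⊗ₖ B = A ⊗ₖ B - A' ⊗ₖ B := by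
  ext
  simp [sub_mul]

lemma kronecker_sub {α β : Type*} (A : Matrix α α ℂ) (B B' : Matrix β β ℂ) :
    A ⊗ₖ (B - B') = A ⊗ₖ B - A ⊗ₖ B' := by
  ext
  simp [mul_sub]

lemma kronecker_half_add {α : Type*} [DecidableEq α] {z : Bits 1} {C : Bits 1 → Matrix α α ℂ}
    (hC : ∑ a, C a = 1) :
    ∑ a, Mproj z a ⊗ₖ C a =
      (1 / 2 : ℂ) • (1 + pauli z ⊗ₖ (C (fun _ => true) - C (fun _ => false))) := by
  have hM := sum_Mproj_one z
  rw [sum_bits_one] at hM hC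
  have h1 : (1 : Matrix (Bits 1 × α) (Bits 1 × α) ℂ) =
      (Mproj z (fun _ => true) + Mproj z (fun _ => false)) ⊗ₖ
        (C (fun _ => true) + C (fun _ => false)) := by
    rw [hM, hC, Matrix.one_kronecker_one]
  rw [h1, sum_bits_one, pauli]
  ext ⟨i, j⟩ ⟨i', j'⟩
  simp only [Matrix.sub_apply, Matrix.add_apply, Matrix.kronecker_apply, Matrix.smul_apply,
    smul_eq_mul]
  ring

variable {α β : Type*} [Fintype α] [Fintype β] [DecidableEq α] [DecidableEq β]

lemma guessOp_posSemidef (z : Bits 1) {A : Bits 1 → Matrix α α ℂ} {B : Bits 1 → Matrix β β ℂ}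
    (hA : IsPOVM A) (hB : IsPOVM B) : (guessOp z A B).PosSemidef :=
  Matrix.posSemidef_sum _ fun a _ =>
    (Mproj_posSemidef z a).kronecker ((hA.1 a).kronecker (hB.1 a))

lemma one_sub_guessOp_posSemidef (z : Bits 1) {A : Bits 1 → Matrix α α ℂ}
    {B : Bits 1 → Matrix β β ℂ} (hA : IsPOVM A) (hB : IsPOVM B) :
    (1 - guessOp z A B).PosSemidef := by
  have h : 1 - guessOp z A B = ∑ a, (Mproj z a ⊗ₖ ((1 - A a) ⊗ₖ (1 : Matrix β β ℂ)) +
      Mproj z a ⊗ₖ (A a ⊗ₖ (1 - B a))) := by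
    have h1 : (1 : Matrix (Bits 1 × α × β) (Bits 1 × α × β) ℂ) =
        ∑ a, Mproj z a ⊗ₖ ((1 : Matrix α α ℂ) ⊗ₖ (1 : Matrix β β ℂ)) := by
      have := congrArg (fun M => M ⊗ₖ ((1 : Matrix α α ℂ) ⊗ₖ (1 : Matrix β β ℂ))) (sum_Mproj_one z)
      simp only [sum_bits_one, Matrix.add_kronecker] at this ⊢
      rw [this]
      simp
    rw [guessOp, h1, ← Finset.sum_sub_distrib]
    refine Finset.sum_congr rfl fun a _ => ?_
    ext ⟨i, j, k⟩ ⟨i', j', k'⟩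
    simp only [Matrix.sub_apply, Matrix.add_apply, Matrix.kronecker_apply]
    ring
  rw [h]
  exact Matrix.posSemidef_sum _ fun a _ =>
    ((Mproj_posSemidef z a).kronecker ((hA.one_sub_posSemidef a).kronecker .one)).add
      ((Mproj_posSemidef z a).kronecker ((hA.1 a).kronecker (hB.one_sub_posSemidef a)))

lemma isPOVM_kronecker_one {A : Bits 1 → Matrix α α ℂ} (hA : IsPOVM A) :
    IsPOVM fun a => A a ⊗ₖ (1 : Matrix β β ℂ) := by
  refine ⟨fun a => (hA.1 a).kronecker .one, ?_⟩
  have := congrArg (fun M => M ⊗ₖ (1 : Matrix β β ℂ)) hA.2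
  simpa only [sum_bits_one, Matrix.add_kronecker, Matrix.one_kronecker_one] using this

lemma isPOVM_one_kronecker {A : Bits 1 → Matrix α α ℂ} (hA : IsPOVM A) :
    IsPOVM fun a => (1 : Matrix β β ℂ) ⊗ₖ A a := by
  refine ⟨fun a => Matrix.PosSemidef.one.kronecker (hA.1 a), ?_⟩
  have := congrArg (fun M => (1 : Matrix β β ℂ) ⊗ₖ M) hA.2
  simpa only [sum_bits_one, Matrix.kronecker_add, Matrix.one_kronecker_one] using this

/-- The Tomamichel–Fehr–Kaniewski–Wehner bound for the BB84 monogamy-of-entanglement game. -/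
lemma guessOp_add_le {A A' : Bits 1 → Matrix α α ℂ} {B B' : Bits 1 → Matrix β β ℂ}
    (hA : IsPOVM A) (hA' : IsPOVM A') (hB : IsPOVM B) (hB' : IsPOVM B')
    (v : Bits 1 × α × β → ℂ) (hv : ∑ i, ‖v i‖ ^ 2 = 1) :
    (star v ⬝ᵥ (guessOp (fun _ => true) A B *ᵥ v)).re +
      (star v ⬝ᵥ (guessOp (fun _ => false) A' B' *ᵥ v)).re ≤
      2 * (1 / 2 + 1 / (2 * Real.sqrt 2)) := by
  set X := pauli (fun _ => true)
  set Z := pauli (fun _ => false)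
  set a := A (fun _ => true) - A (fun _ => false) with ha
  set b := B' (fun _ => true) - B' (fun _ => false) with hb
  set T := X ⊗ₖ (a ⊗ₖ (1 : Matrix β β ℂ)) with hT
  set S := Z ⊗ₖ ((1 : Matrix α α ℂ) ⊗ₖ b) with hS
  have hTn : ‖T‖ ≤ 1 := (l2_opNorm_kronecker_le _ _).trans (mul_le_one₀ (norm_pauli_le _)
    (norm_nonneg _) ((l2_opNorm_kronecker_one_le _).trans hA.norm_sub_le))
  have hSn : ‖S‖ ≤ 1 := (l2_opNorm_kronecker_le _ _).trans (mul_le_one₀ (norm_pauli_le _)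
    (norm_nonneg _) ((l2_opNorm_one_kronecker_le _).trans hB'.norm_sub_le))
  have haH : a.IsHermitian := (hA.1 _).isHermitian.sub (hA.1 _).isHermitian
  have hbH : b.IsHermitian := (hB'.1 _).isHermitian.sub (hB'.1 _).isHermitian
  have hTH : Tᴴ = T := by
    rw [hT, Matrix.conjTranspose_kronecker, Matrix.conjTranspose_kronecker, haH.eq,
      (pauli_isHermitian _).eq, Matrix.conjTranspose_one]
  have hSH : Sᴴ = S := by
    rw [hS, Matrix.conjTranspose_kronecker, Matrix.conjTranspose_kronecker, hbH.eq,
      (pauli_isHermitian _).eq, Matrix.conjTranspose_one]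
  have hTS : T * S + S * T = 0 := by
    rw [hT, hS, ← Matrix.mul_kronecker_mul, ← Matrix.mul_kronecker_mul, ← Matrix.mul_kronecker_mul,
      ← Matrix.mul_kronecker_mul, Matrix.mul_one, Matrix.one_mul, Matrix.mul_one, Matrix.one_mul,
      ← Matrix.add_kronecker, pauli_anticomm, Matrix.zero_kronecker]
  have hsum : ‖T + S‖ ≤ Real.sqrt 2 := by
    refine Real.le_sqrt_of_sq_le ?_
    have h1 : (T + S)ᴴ * (T + S) = T * T + S * S := by
      rw [Matrix.conjTranspose_add, hTH, hSH]
      calc (T + S) * (T + S) = T * T + S * S + (T * S + S * T) := by noncomm_ring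
        _ = _ := by rw [hTS, add_zero]
    rw [sq, ← Matrix.l2_opNorm_conjTranspose_mul_self, h1]
    have h2 : ‖T * T‖ ≤ 1 := (Matrix.l2_opNorm_mul _ _).trans (mul_le_one₀ hTn (norm_nonneg _) hTn)
    have h3 : ‖S * S‖ ≤ 1 := (Matrix.l2_opNorm_mul _ _).trans (mul_le_one₀ hSn (norm_nonneg _) hSn)
    linarith [norm_add_le (T * T) (S * S)]
  have hP : ((∑ a, Mproj (fun _ => true) a ⊗ₖ (A a ⊗ₖ (1 : Matrix β β ℂ))) -
      guessOp (fun _ => true) A B).PosSemidef := by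
    rw [guessOp, ← Finset.sum_sub_distrib]
    refine Matrix.posSemidef_sum _ fun a _ => ?_
    have h : Mproj (fun _ => true) a ⊗ₖ (A a ⊗ₖ (1 : Matrix β β ℂ)) -
        Mproj (fun _ => true) a ⊗ₖ (A a ⊗ₖ B a) =
        Mproj (fun _ => true) a ⊗ₖ (A a ⊗ₖ (1 - B a)) := by
      ext ⟨i, j, k⟩ ⟨i', j', k'⟩
      simp only [Matrix.sub_apply, Matrix.kronecker_apply]
      ring
    rw [h]
    exact (Mproj_posSemidef _ a).kronecker ((hA.1 a).kronecker (hB.one_sub_posSemidef a))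
  have hQ : ((∑ a, Mproj (fun _ => false) a ⊗ₖ ((1 : Matrix α α ℂ) ⊗ₖ B' a)) -
      guessOp (fun _ => false) A' B').PosSemidef := by
    rw [guessOp, ← Finset.sum_sub_distrib]
    refine Matrix.posSemidef_sum _ fun a _ => ?_
    have h : Mproj (fun _ => false) a ⊗ₖ ((1 : Matrix α α ℂ) ⊗ₖ B' a) -
        Mproj (fun _ => false) a ⊗ₖ (A' a ⊗ₖ B' a) =
        Mproj (fun _ => false) a ⊗ₖ ((1 - A' a) ⊗ₖ B' a) := by
      ext ⟨i, j, k⟩ ⟨i', j', k'⟩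
      simp only [Matrix.sub_apply, Matrix.kronecker_apply]
      ring
    rw [h]
    exact (Mproj_posSemidef _ a).kronecker ((hA'.one_sub_posSemidef a).kronecker (hB'.1 a))
  have hPv := hP.dotProduct_mulVec_nonneg v
  have hQv := hQ.dotProduct_mulVec_nonneg v
  rw [Matrix.sub_mulVec, dotProduct_sub, sub_nonneg] at hPv hQv
  replace hPv := (Complex.le_def.1 hPv).1
  replace hQv := (Complex.le_def.1 hQv).1
  have hvv : (star v ⬝ᵥ v).re = 1 := by rw [star_dotProduct_self, Complex.ofReal_re, hv]
  have hPeq : ∑ a, Mproj (fun _ => true) a ⊗ₖ (A a ⊗ₖ (1 : Matrix β β ℂ)) =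
      (1 / 2 : ℂ) • (1 + T) := by
    rw [kronecker_half_add (isPOVM_kronecker_one hA).2, hT, ha, sub_kronecker]
  have hQeq : ∑ a, Mproj (fun _ => false) a ⊗ₖ ((1 : Matrix α α ℂ) ⊗ₖ B' a) =
      (1 / 2 : ℂ) • (1 + S) := by
    rw [kronecker_half_add (isPOVM_one_kronecker hB').2, hS, hb,
      kronecker_sub (1 : Matrix α α ℂ)]
  have hhalf : ∀ C : Matrix (Bits 1 × α × β) (Bits 1 × α × β) ℂ,
      (star v ⬝ᵥ (((1 / 2 : ℂ) • (1 + C)) *ᵥ v)).re = 1 / 2 + (star v ⬝ᵥ (C *ᵥ v)).re / 2 := by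
    intro C
    rw [Matrix.smul_mulVec, dotProduct_smul, Matrix.add_mulVec, Matrix.one_mulVec, dotProduct_add,
      smul_eq_mul]
    have : (1 / 2 : ℂ) = ((1 / 2 : ℝ) : ℂ) := by norm_num
    rw [this, Complex.re_ofReal_mul, Complex.add_re, hvv]
    ring
  rw [hPeq, hhalf] at hPv
  rw [hQeq, hhalf] at hQv
  have hTSv : (star v ⬝ᵥ (T *ᵥ v)).re + (star v ⬝ᵥ (S *ᵥ v)).re ≤ Real.sqrt 2 := by
    rw [← Complex.add_re, ← dotProduct_add, ← Matrix.add_mulVec]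
    exact (re_dotProduct_mulVec_le _ v hv).trans hsum
  have hsqrt : 1 / (2 * Real.sqrt 2) = Real.sqrt 2 / 4 := by
    have h2 : Real.sqrt 2 * Real.sqrt 2 = 2 := Real.mul_self_sqrt (by norm_num)
    field_simp
    nlinarith
  rw [hsqrt]
  linarith

end MonogamyGame

section Strategies

open scoped Matrix.Norms.L2Operator

variable {α β : Type*} [Fintype α] [Fintype β] [DecidableEq α] [DecidableEq β]

/-- The best probability with which two players sharing the last two registers of `v` both guess
the outcome of a measurement of the first register in basis `z`. -/
def optGuess (z : Bits 1) (v : Bits 1 × α × β → ℂ) : ℝ :=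
  ⨆ p : {p : (Bits 1 → Matrix α α ℂ) × (Bits 1 → Matrix β β ℂ) // IsPOVM p.1 ∧ IsPOVM p.2},
    (star v ⬝ᵥ (guessOp z p.1.1 p.1.2 *ᵥ v)).re

lemma guess_nonneg (z : Bits 1) {A : Bits 1 → Matrix α α ℂ} {B : Bits 1 → Matrix β β ℂ}
    (hA : IsPOVM A) (hB : IsPOVM B) (v : Bits 1 × α × β → ℂ) :
    0 ≤ (star v ⬝ᵥ (guessOp z A B *ᵥ v)).re :=
  (Complex.le_def.1 ((guessOp_posSemidef z hA hB).dotProduct_mulVec_nonneg v)).1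

lemma guess_le_one (z : Bits 1) {A : Bits 1 → Matrix α α ℂ} {B : Bits 1 → Matrix β β ℂ}
    (hA : IsPOVM A) (hB : IsPOVM B) {v : Bits 1 × α × β → ℂ} (hv : ∑ i, ‖v i‖ ^ 2 = 1) :
    (star v ⬝ᵥ (guessOp z A B *ᵥ v)).re ≤ 1 := by
  have h := (one_sub_guessOp_posSemidef z hA hB).dotProduct_mulVec_nonneg v
  rw [Matrix.sub_mulVec, Matrix.one_mulVec, dotProduct_sub, sub_nonneg, star_dotProduct_self,
    hv] at h
  exact (Complex.le_def.1 h).1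

lemma guess_le_optGuess (z : Bits 1) {A : Bits 1 → Matrix α α ℂ} {B : Bits 1 → Matrix β β ℂ}
    (hA : IsPOVM A) (hB : IsPOVM B) {v : Bits 1 × α × β → ℂ} (hv : ∑ i, ‖v i‖ ^ 2 = 1) :
    (star v ⬝ᵥ (guessOp z A B *ᵥ v)).re ≤ optGuess z v :=
  le_ciSup (f := fun p : {p : (Bits 1 → Matrix α α ℂ) × (Bits 1 → Matrix β β ℂ) //
    IsPOVM p.1 ∧ IsPOVM p.2} => (star v ⬝ᵥ (guessOp z p.1.1 p.1.2 *ᵥ v)).re)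
    ⟨1, by rintro _ ⟨p, rfl⟩; exact guess_le_one z p.2.1 p.2.2 hv⟩ ⟨(A, B), hA, hB⟩

lemma optGuess_nonneg (z : Bits 1) (v : Bits 1 × α × β → ℂ) : 0 ≤ optGuess z v :=
  Real.iSup_nonneg fun p => guess_nonneg z p.2.1 p.2.2 v

lemma optGuess_le_one (z : Bits 1) {v : Bits 1 × α × β → ℂ} (hv : ∑ i, ‖v i‖ ^ 2 = 1) :
    optGuess z v ≤ 1 :=
  Real.iSup_le (fun p => guess_le_one z p.2.1 p.2.2 hv) zero_le_one

lemma sum_optGuess_le {v : Bits 1 × α × β → ℂ} (hv : ∑ i, ‖v i‖ ^ 2 = 1) :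
    ∑ z, optGuess z v ≤ 2 * (1 / 2 + 1 / (2 * Real.sqrt 2)) := by
  have hpos : (1 : ℝ) ≤ 2 * (1 / 2 + 1 / (2 * Real.sqrt 2)) := by
    have : 0 < 1 / (2 * Real.sqrt 2) := by positivity
    linarith
  rw [sum_bits_one, ← le_sub_iff_add_le]
  refine Real.iSup_le (fun p => ?_) (by linarith [optGuess_le_one (fun _ => false) hv])
  rw [le_sub_comm]
  refine Real.iSup_le (fun p' => ?_) (by linarith [guess_le_one (fun _ => true) p.2.1 p.2.2 hv])
  linarith [guessOp_add_le p.2.1 p'.2.1 p.2.2 p'.2.2 v hv]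

lemma optGuess_le_add (z : Bits 1) {v w : Bits 1 × α × β → ℂ} (hv : ∑ i, ‖v i‖ ^ 2 = 1)
    (hw : ∑ i, ‖w i‖ ^ 2 = 1) :
    optGuess z v ≤ optGuess z w + 2 * ‖WithLp.toLp 2 (v - w)‖ := by
  refine Real.iSup_le (fun p => ?_) (add_nonneg (optGuess_nonneg z w) (by positivity))
  refine (re_dotProduct_mulVec_sub_le (guessOp_posSemidef z p.2.1 p.2.2)
    (one_sub_guessOp_posSemidef z p.2.1 p.2.2) v w hv hw).trans ?_
  gcongr
  exact guess_le_optGuess z p.2.1 p.2.2 hw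

/-- The canonical reordering of the registers during the communication phase. -/
def swapRegisters (κ α β γ δ : Type*) : κ × (α × δ) × (γ × β) ≃ κ × (α × β) × (γ × δ) where
  toFun u := (u.1, (u.2.1.1, u.2.2.2), (u.2.2.1, u.2.1.2))
  invFun u := (u.1, (u.2.1.1, u.2.2.2), (u.2.2.1, u.2.1.2))
  left_inv _ := rfl
  right_inv _ := rfl

/-- The state after the local unitaries `U`, `V` and the exchange of the second registers. -/
def exchangedState {κ α β γ δ : Type*} [Fintype κ] [Fintype α] [Fintype β] [Fintype γ] [Fintype δ]
    [DecidableEq κ] (φ : κ × (α × β) × (γ × δ) → ℂ) (U : Matrix (α × β) (α × β) ℂ)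
    (V : Matrix (γ × δ) (γ × δ) ℂ) : κ × (α × δ) × (γ × β) → ℂ :=
  (((1 : Matrix κ κ ℂ) ⊗ₖ (U ⊗ₖ V)) *ᵥ φ) ∘ swapRegisters κ α β γ δ

section

variable {κ γ δ : Type*} [Fintype κ] [Fintype γ] [Fintype δ] [DecidableEq κ] [DecidableEq γ]
  [DecidableEq δ]

lemma sum_norm_sq_exchangedState {φ : κ × (α × β) × (γ × δ) → ℂ} {U : Matrix (α × β) (α × β) ℂ}
    {V : Matrix (γ × δ) (γ × δ) ℂ} (hφ : ∑ i, ‖φ i‖ ^ 2 = 1)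
    (hU : U ∈ Matrix.unitaryGroup (α × β) ℂ) (hV : V ∈ Matrix.unitaryGroup (γ × δ) ℂ) :
    ∑ i, ‖exchangedState φ U V i‖ ^ 2 = 1 := by
  have hunit : ((1 : Matrix κ κ ℂ) ⊗ₖ (U ⊗ₖ V))ᴴ * ((1 : Matrix κ κ ℂ) ⊗ₖ (U ⊗ₖ V)) = 1 := by
    have hU' : Uᴴ * U = 1 := Matrix.mem_unitaryGroup_iff'.1 hU
    have hV' : Vᴴ * V = 1 := Matrix.mem_unitaryGroup_iff'.1 hV
    rw [Matrix.conjTranspose_kronecker, Matrix.conjTranspose_kronecker, ← Matrix.mul_kronecker_mul,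
      ← Matrix.mul_kronecker_mul, hU', hV', Matrix.conjTranspose_one, Matrix.mul_one,
      Matrix.one_kronecker_one, Matrix.one_kronecker_one]
  have h := star_dotProduct_conjTranspose_mul_self ((1 : Matrix κ κ ℂ) ⊗ₖ (U ⊗ₖ V)) φ
  rw [hunit, Matrix.one_mulVec, star_dotProduct_self, hφ] at h
  refine Eq.trans ?_ (Complex.ofReal_injective h).symm
  exact Equiv.sum_comp (swapRegisters κ α β γ δ)
    (fun i => ‖(((1 : Matrix κ κ ℂ) ⊗ₖ (U ⊗ₖ V)) *ᵥ φ) i‖ ^ 2)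

lemma norm_exchangedState_sub_le {φ φ' : κ × (α × β) × (γ × δ) → ℂ}
    {U U' : Matrix (α × β) (α × β) ℂ} {V V' : Matrix (γ × δ) (γ × δ) ℂ} {r : ℝ}
    (hφ : ‖WithLp.toLp 2 φ‖ ≤ 1) (hU' : ‖U'‖ ≤ 1) (hV : ‖V‖ ≤ 1) (hV' : ‖V'‖ ≤ 1)
    (hφφ' : ‖WithLp.toLp 2 φ - WithLp.toLp 2 φ'‖ ≤ r) (hUU' : ‖U - U'‖ ≤ r)
    (hVV' : ‖V - V'‖ ≤ r) :
    ‖WithLp.toLp 2 (exchangedState φ U V - exchangedState φ' U' V')‖ ≤ 3 * r := by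
  have hr : 0 ≤ r := (norm_nonneg _).trans hφφ'
  set W := (1 : Matrix κ κ ℂ) ⊗ₖ (U ⊗ₖ V) with hW
  set W' := (1 : Matrix κ κ ℂ) ⊗ₖ (U' ⊗ₖ V') with hW'
  have hnorm : ‖WithLp.toLp 2 (exchangedState φ U V - exchangedState φ' U' V')‖ =
      ‖WithLp.toLp 2 (W *ᵥ φ - W' *ᵥ φ')‖ := by
    rw [← sq_eq_sq₀ (norm_nonneg _) (norm_nonneg _), EuclideanSpace.norm_sq_eq,
      EuclideanSpace.norm_sq_eq]
    exact Equiv.sum_comp (swapRegisters κ α β γ δ) (fun i => ‖(W *ᵥ φ - W' *ᵥ φ') i‖ ^ 2)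
  have hsplit : W *ᵥ φ - W' *ᵥ φ' = (W - W') *ᵥ φ + W' *ᵥ (φ - φ') := by
    rw [Matrix.sub_mulVec, Matrix.mulVec_sub]
    abel
  have hWW' : ‖W - W'‖ ≤ 2 * r := by
    have h : W - W' = (1 : Matrix κ κ ℂ) ⊗ₖ ((U - U') ⊗ₖ V + U' ⊗ₖ (V - V')) := by
      rw [sub_kronecker, kronecker_sub, sub_add_sub_cancel, kronecker_sub]
    rw [h]
    refine (l2_opNorm_one_kronecker_le _).trans ((norm_add_le _ _).trans ?_)
    have h1 : ‖(U - U') ⊗ₖ V‖ ≤ r * 1 :=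
      (l2_opNorm_kronecker_le _ _).trans (mul_le_mul hUU' hV (norm_nonneg _) hr)
    have h2 : ‖U' ⊗ₖ (V - V')‖ ≤ 1 * r :=
      (l2_opNorm_kronecker_le _ _).trans (mul_le_mul hU' hVV' (norm_nonneg _) zero_le_one)
    linarith
  have hW'1 : ‖W'‖ ≤ 1 := (l2_opNorm_one_kronecker_le _).trans
    ((l2_opNorm_kronecker_le _ _).trans (mul_le_one₀ hU' (norm_nonneg _) hV'))
  rw [hnorm, hsplit, WithLp.toLp_add]
  refine (norm_add_le _ _).trans ?_
  have h1 : ‖WithLp.toLp 2 ((W - W') *ᵥ φ)‖ ≤ (2 * r) * 1 :=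
    ((W - W').l2_opNorm_mulVec (WithLp.toLp 2 φ)).trans
      (mul_le_mul hWW' hφ (norm_nonneg _) (by positivity))
  have h2 : ‖WithLp.toLp 2 (W' *ᵥ (φ - φ'))‖ ≤ 1 * r :=
    (W'.l2_opNorm_mulVec (WithLp.toLp 2 (φ - φ'))).trans
      (mul_le_mul hW'1 hφφ' (norm_nonneg _) zero_le_one)
  linarith

end

lemma norm_le_one_of_mem_unitaryGroup {ι : Type*} [Fintype ι] [DecidableEq ι] {U : Matrix ι ι ℂ}
    (hU : U ∈ Matrix.unitaryGroup ι ℂ) : ‖U‖ ≤ 1 := by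
  refine l2_opNorm_le_one ?_
  have h : Uᴴ * U = 1 := Matrix.mem_unitaryGroup_iff'.1 hU
  rw [h, sub_self]
  exact .zero

lemma norm_toLp_le_one {ι : Type*} [Fintype ι] {v : ι → ℂ} (hv : ∑ i, ‖v i‖ ^ 2 = 1) :
    ‖WithLp.toLp 2 v‖ ≤ 1 := by
  rw [← sq_le_sq₀ (norm_nonneg _) zero_le_one, EuclideanSpace.norm_sq_eq, one_pow]
  exact hv.le

lemma card_bits_prod (n : ℕ) : Fintype.card (Bits n × Bits n) = 2 ^ (2 * n) := by
  simp only [Fintype.card_prod, Fintype.card_fun, Fintype.card_bool, Fintype.card_fin]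
  rw [← pow_add, two_mul]

/-- The functions for which some attack with registers `α, β` on one side and `γ, δ` on the other
wins on average with probability at least `w`. -/
def attackable (n : ℕ) (α β γ δ : Type*) [Fintype α] [Fintype β] [Fintype γ] [Fintype δ]
    [DecidableEq α] [DecidableEq β] [DecidableEq γ] [DecidableEq δ] (w : ℝ) :
    Set (Bits n × Bits n → Bits 1) :=
  {f | ∃ (φ : Bits 1 × (α × β) × (γ × δ) → ℂ) (U : Bits n → Matrix (α × β) (α × β) ℂ)
    (V : Bits n → Matrix (γ × δ) (γ × δ) ℂ), ∑ i, ‖φ i‖ ^ 2 = 1 ∧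
      (∀ x, U x ∈ Matrix.unitaryGroup (α × β) ℂ) ∧ (∀ y, V y ∈ Matrix.unitaryGroup (γ × δ) ℂ) ∧
      w * Fintype.card (Bits n × Bits n) ≤
        ∑ p : Bits n × Bits n, optGuess (f p) (exchangedState φ (U p.1) (V p.2))}

lemma ncard_attackable_le (n k : ℕ) (α β γ δ : Type*) [Fintype α] [Fintype β] [Fintype γ]
    [Fintype δ] [DecidableEq α] [DecidableEq β] [DecidableEq γ] [DecidableEq δ] {t : ℝ}
    (ht : 0 ≤ t) {d : ℕ} (hd₁ : Fintype.card (α × β) = d) (hd₂ : Fintype.card (γ × δ) = d) :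
    ((attackable n α β γ δ (1 / 2 + 1 / (2 * Real.sqrt 2) + t + 6 * (1 / 2) ^ k)).ncard : ℝ) ≤
      2 ^ ((k + 3) * (4 * d ^ 2 * (2 ^ n + 1))) *
        (2 ^ (2 ^ (2 * n)) * Real.exp (-(2 * t ^ 2 * 2 ^ (2 * n)))) := by
  classical
  obtain ⟨cellφ, hcellφ⟩ := exists_cell_map (EuclideanSpace ℂ (Bits 1 × (α × β) × (γ × δ))) k
  obtain ⟨cellU, hcellU⟩ := exists_cell_map (Matrix (α × β) (α × β) ℂ) k
  obtain ⟨cellV, hcellV⟩ := exists_cell_map (Matrix (γ × δ) (γ × δ) ℂ) k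
  let Att := (Bits 1 × (α × β) × (γ × δ) → ℂ) × (Bits n → Matrix (α × β) (α × β) ℂ) ×
    (Bits n → Matrix (γ × δ) (γ × δ) ℂ)
  let Valid : Att → Prop := fun s => ∑ i, ‖s.1 i‖ ^ 2 = 1 ∧
    (∀ x, s.2.1 x ∈ Matrix.unitaryGroup (α × β) ℂ) ∧
    (∀ y, s.2.2 y ∈ Matrix.unitaryGroup (γ × δ) ℂ)
  let code := fun s : Att =>
    (cellφ (WithLp.toLp 2 s.1), fun x => cellU (s.2.1 x), fun y => cellV (s.2.2 y))
  let val : Att → (Bits n × Bits n → Bits 1) → ℝ := fun s f =>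
    ∑ p : Bits n × Bits n, optGuess (f p) (exchangedState s.1 (s.2.1 p.1) (s.2.2 p.2))
  set l : ℝ := 1 / 2 + 1 / (2 * Real.sqrt 2)
  set N : ℕ := Fintype.card (Bits n × Bits n)
  have hNeq : N = 2 ^ (2 * n) := card_bits_prod n
  have hunit : ∀ s, Valid s → ∀ p : Bits n × Bits n,
      ∑ i, ‖exchangedState s.1 (s.2.1 p.1) (s.2.2 p.2) i‖ ^ 2 = 1 := fun s hs p =>
    sum_norm_sq_exchangedState hs.1 (hs.2.1 p.1) (hs.2.2 p.2)
  have hclose : ∀ s s', Valid s → Valid s' → code s = code s' → ∀ f,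
      val s f ≤ val s' f + 6 * (1 / 2) ^ k * N := by
    intro s s' hs hs' hss' f
    have h1 := congrArg Prod.fst hss'
    have h2 := fun x => congrFun (congrArg (fun c => c.2.1) hss') x
    have h3 := fun y => congrFun (congrArg (fun c => c.2.2) hss') y
    have hconst : 6 * (1 / 2) ^ k * (N : ℝ) = ∑ _p : Bits n × Bits n, 6 * (1 / 2 : ℝ) ^ k := by
      rw [Finset.sum_const, Finset.card_univ, nsmul_eq_mul, mul_comm]
    rw [hconst, ← Finset.sum_add_distrib]
    refine Finset.sum_le_sum fun p _ => ?_
    refine (optGuess_le_add (f p) (hunit s hs p) (hunit s' hs' p)).trans ?_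
    have := norm_exchangedState_sub_le (r := (1 / 2) ^ k) (norm_toLp_le_one hs.1)
      (norm_le_one_of_mem_unitaryGroup (hs'.2.1 p.1))
      (norm_le_one_of_mem_unitaryGroup (hs.2.2 p.2))
      (norm_le_one_of_mem_unitaryGroup (hs'.2.2 p.2))
      (hcellφ _ _ (norm_toLp_le_one hs.1) (norm_toLp_le_one hs'.1) h1)
      (hcellU _ _ (norm_le_one_of_mem_unitaryGroup (hs.2.1 p.1))
        (norm_le_one_of_mem_unitaryGroup (hs'.2.1 p.1)) (h2 p.1))
      (hcellV _ _ (norm_le_one_of_mem_unitaryGroup (hs.2.2 p.2))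
        (norm_le_one_of_mem_unitaryGroup (hs'.2.2 p.2)) (h3 p.2))
    linarith
  have hcell : ∀ c, (({f | ∃ s, Valid s ∧ code s = c ∧ (l + t + 6 * (1 / 2) ^ k) * N ≤ val s f} :
      Set (Bits n × Bits n → Bits 1)).ncard : ℝ) ≤ 2 ^ N * Real.exp (-(2 * t ^ 2 * N)) := by
    intro c
    by_cases hc : ∃ s, Valid s ∧ code s = c
    · obtain ⟨s₀, hs₀, rfl⟩ := hc
      refine le_trans ?_ (ncard_le_sum_le (P := Bits n × Bits n) (Z := Bits 1) (by simp)
        (fun z p => optGuess z (exchangedState s₀.1 (s₀.2.1 p.1) (s₀.2.2 p.2)))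
        (fun z p => optGuess_nonneg z _) (fun z p => optGuess_le_one z (hunit s₀ hs₀ p)) (l := l)
        (fun p => sum_optGuess_le (hunit s₀ hs₀ p)) ht)
      refine Nat.cast_le.2 (Set.ncard_le_ncard ?_ (Set.toFinite _))
      rintro f ⟨s, hs, hcode, hf⟩
      have := hclose s s₀ hs hs₀ hcode f
      change (l + t) * N ≤ val s₀ f
      linarith
    · have hempty : ({f | ∃ s, Valid s ∧ code s = c ∧ (l + t + 6 * (1 / 2) ^ k) * N ≤ val s f} :
          Set (Bits n × Bits n → Bits 1)) = ∅ := by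
        refine Set.eq_empty_of_forall_notMem ?_
        rintro f ⟨s, hs, hcode, -⟩
        exact hc ⟨s, hs, hcode⟩
      rw [hempty, Set.ncard_empty, Nat.cast_zero]
      positivity
  have hsub : attackable n α β γ δ (l + t + 6 * (1 / 2) ^ k) ⊆
      ⋃ c, {f | ∃ s, Valid s ∧ code s = c ∧ (l + t + 6 * (1 / 2) ^ k) * N ≤ val s f} := by
    rintro f ⟨φ, U, V, hφ, hU, hV, hf⟩
    exact Set.mem_iUnion.2 ⟨code (φ, U, V), (φ, U, V), ⟨hφ, hU, hV⟩, rfl, hf⟩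
  have hbits : Fintype.card (Bits 1) = 2 := by simp
  have hfinφ : Module.finrank ℝ (EuclideanSpace ℂ (Bits 1 × (α × β) × (γ × δ))) = 4 * d ^ 2 := by
    rw [← Module.finrank_mul_finrank ℝ ℂ, Complex.finrank_real_complex, finrank_euclideanSpace,
      Fintype.card_prod, Fintype.card_prod, hd₁, hd₂, hbits]
    ring
  have hfinU : Module.finrank ℝ (Matrix (α × β) (α × β) ℂ) = 2 * d ^ 2 := by
    rw [Module.finrank_matrix, Complex.finrank_real_complex, hd₁]
    ring
  have hfinV : Module.finrank ℝ (Matrix (γ × δ) (γ × δ) ℂ) = 2 * d ^ 2 := by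
    rw [Module.finrank_matrix, Complex.finrank_real_complex, hd₂]
    ring
  have hcard : Fintype.card (Fin (2 ^ ((k + 3) *
      Module.finrank ℝ (EuclideanSpace ℂ (Bits 1 × (α × β) × (γ × δ))))) ×
      (Bits n → Fin (2 ^ ((k + 3) * Module.finrank ℝ (Matrix (α × β) (α × β) ℂ)))) ×
      (Bits n → Fin (2 ^ ((k + 3) * Module.finrank ℝ (Matrix (γ × δ) (γ × δ) ℂ))))) =
      2 ^ ((k + 3) * (4 * d ^ 2 * (2 ^ n + 1))) := by
    rw [hfinφ, hfinU, hfinV]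
    simp only [Fintype.card_prod, Fintype.card_fun, Fintype.card_fin, Fintype.card_bool]
    rw [← pow_mul, ← pow_add, ← pow_add]
    congr 1
    ring
  have hunion := (Set.ncard_le_ncard hsub (Set.toFinite _)).trans
    (Set.ncard_iUnion_le_of_fintype _)
  refine (Nat.cast_le (α := ℝ).2 hunion).trans ?_
  rw [Nat.cast_sum]
  refine (Finset.sum_le_sum fun c _ => hcell c).trans ?_
  rw [Finset.sum_const, Finset.card_univ, hcard, nsmul_eq_mul, hNeq]
  push_cast
  exact le_rfl

end Strategies

section Counting

lemma sum_qf_one (n : ℕ) (f : Bits n × Bits n → Bits 1) : ∑ z, qf n 1 f z = 1 := by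
  simp only [qf]
  rw [← Finset.sum_div, ← Nat.cast_sum, ← Finset.card_eq_sum_card_fiberwise (s := Finset.univ)
    (fun p _ => Finset.mem_univ (f p)), Finset.card_univ, card_bits_prod]
  push_cast
  exact div_self (by positivity)

/-- At least half of all functions are close to balanced. -/
lemma two_pow_le_two_mul_ncard_Fstar (n : ℕ) {ε : ℝ} (hε0 : 0 < ε) (hε : ε ≤ 1 / 4) :
    (2 : ℝ) ^ (2 ^ (2 * n)) ≤ 2 * ((Fstar n 1 ε).ncard : ℝ) := by
  classical
  set L := Real.log (2 / ε) with hL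
  have hL1 : 1 ≤ L := by
    have h8 : (8 : ℝ) ≤ 2 / ε := by rw [le_div_iff₀ hε0]; linarith
    rw [hL, Real.le_log_iff_exp_le (by positivity)]
    linarith [Real.exp_one_lt_d9]
  set τ : ℝ := Real.sqrt (3 * L) * (2 : ℝ) ^ (-(n : ℝ) - (1 : ℕ) / 2) with hτ
  have hτ0 : 0 ≤ τ := by positivity
  have hτsq : 2 * τ ^ 2 * (2 ^ (2 * n) : ℕ) = 3 * L := by
    have h1 : ((2 : ℝ) ^ (-(n : ℝ) - (1 : ℕ) / 2)) ^ 2 = ((2 : ℝ) ^ (2 * n))⁻¹ * (1 / 2) := by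
      rw [← Real.rpow_natCast, ← Real.rpow_natCast, ← Real.rpow_mul (by norm_num),
        ← Real.rpow_neg (by norm_num)]
      have : (1 / 2 : ℝ) = 2 ^ (-1 : ℝ) := by rw [Real.rpow_neg_one]; norm_num
      rw [this, ← Real.rpow_add (by norm_num)]
      congr 1
      push_cast
      ring
    rw [hτ, mul_pow, h1, Real.sq_sqrt (by positivity)]
    push_cast
    field_simp
  let D : Bits 1 → Set (Bits n × Bits n → Bits 1) := fun z => {f | (1 / 2 + τ) *
    Fintype.card (Bits n × Bits n) ≤ ∑ p, if f p = z then (1 : ℝ) else 0}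
  have hD : ∀ z, ((D z).ncard : ℝ) ≤ 2 ^ (2 ^ (2 * n)) * (1 / 4) := by
    intro z
    have h := ncard_le_sum_le (P := Bits n × Bits n) (Z := Bits 1) (by simp)
      (fun z' _ => if z' = z then (1 : ℝ) else 0) (fun z' p => by positivity)
      (fun z' p => by split_ifs <;> norm_num) (l := 1 / 2) (fun p => by simp) hτ0
    refine h.trans ?_
    rw [card_bits_prod, hτsq]
    gcongr
    rw [Real.exp_neg, one_div]
    gcongr
    have h2 := Real.quadratic_le_exp_of_nonneg (x := 3 * L) (by positivity)
    nlinarith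
  have hcompl : (Fstar n 1 ε)ᶜ ⊆ ⋃ z, D z := by
    intro f hf
    simp only [Fstar, Set.mem_compl_iff, Set.mem_ofPred_eq, not_forall, not_le] at hf
    obtain ⟨z, hz⟩ := hf
    have hhalf : (2 : ℝ) ^ (-((1 : ℕ) : ℝ)) = 1 / 2 := by
      rw [Nat.cast_one, Real.rpow_neg_one, one_div]
    rw [hhalf] at hz
    have hsum := sum_qf_one n f
    have hex : ∃ z', 1 / 2 + τ ≤ qf n 1 f z' := by
      by_contra! hcon
      have hz' := hcon z
      obtain ⟨w, hw⟩ : ∃ w, qf n 1 f z + qf n 1 f w = 1 := by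
        rw [sum_bits_one] at hsum
        rw [bits_one_eq z]
        cases z 0
        · exact ⟨fun _ => true, by linarith⟩
        · exact ⟨fun _ => false, by linarith⟩
      have := hcon w
      have habs : |qf n 1 f z - 1 / 2| ≤ τ := by
        rw [abs_le]
        constructor <;> linarith
      exact absurd habs (not_le.2 hz)
    obtain ⟨z', hz'⟩ := hex
    refine Set.mem_iUnion.2 ⟨z', ?_⟩
    simp only [D, Set.mem_ofPred_eq, Finset.sum_boole]
    rw [qf, le_div_iff₀ (by positivity)] at hz'
    rw [card_bits_prod]
    push_cast
    exact hz'
  have hcomplcard : (((Fstar n 1 ε)ᶜ.ncard : ℕ) : ℝ) ≤ 2 ^ (2 ^ (2 * n)) * (1 / 2) := by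
    have h := (Set.ncard_le_ncard hcompl (Set.toFinite _)).trans
      (Set.ncard_iUnion_le_of_fintype _)
    rw [sum_bits_one] at h
    have h' : (((Fstar n 1 ε)ᶜ.ncard : ℕ) : ℝ) ≤
        ((D fun _ => true).ncard : ℝ) + ((D fun _ => false).ncard : ℝ) := by exact_mod_cast h
    linarith [hD fun _ => true, hD fun _ => false]
  have htotal : ((Fstar n 1 ε).ncard : ℝ) + ((Fstar n 1 ε)ᶜ.ncard : ℝ) = 2 ^ (2 ^ (2 * n)) := by
    have h := Set.ncard_add_ncard_compl (Fstar n 1 ε)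
    rw [Nat.card_eq_fintype_card, Fintype.card_fun, card_bits_prod] at h
    have hbits : Fintype.card (Bits 1) = 2 := by simp
    rw [hbits] at h
    exact_mod_cast h
  linarith

lemma BB84Strategy.mem_attackable {n q : ℕ} (S : BB84Strategy n 1 q)
    {f : Bits n × Bits n → Bits 1} {w : ℝ} (hw : w ≤ S.win 0 f) :
    f ∈ attackable n (Bits S.qAk) (Bits S.qAc) (Bits S.qBk) (Bits S.qBc) w := by
  refine ⟨S.φ, S.U, S.V, S.hφ, S.hU, S.hV, ?_⟩
  have hwin : S.win 0 f ≤ (1 / 2 ^ (2 * n) : ℝ) *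
      ∑ p : Bits n × Bits n, optGuess (f p) (exchangedState S.φ (S.U p.1) (S.V p.2)) := by
    rw [BB84Strategy.win, Fintype.sum_prod_type]
    gcongr with x _ y _
    refine le_trans (le_of_eq ?_) (guess_le_optGuess (f (x, y)) (S.hA x y) (S.hB x y)
      (sum_norm_sq_exchangedState S.hφ (S.hU x) (S.hV y)))
    have hfilter : ∀ a : Bits 1, (Finset.univ.filter
        fun a' : Bits 1 => (hammingDist a a' : ℝ) ≤ 0 * (1 : ℕ)) = {a} := by
      intro a
      ext a'
      simp [eq_comm]
    simp only [hfilter, Finset.sum_singleton]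
    rw [guessOp, Matrix.sum_mulVec, dotProduct_sum, Complex.re_sum]
    rfl
  rw [card_bits_prod]
  push_cast
  rw [one_div_mul_eq_div] at hwin
  exact (le_div_iff₀ (by positivity)).1 (hw.trans hwin)

end Counting

section Soundness

lemma bb84_const_bounds :
    (853 / 1000 : ℝ) < 1 / 2 + 1 / (2 * √2) ∧ 1 / 2 + 1 / (2 * √2) < (854 / 1000 : ℝ) := by
  have h1 : (1.4142 : ℝ) < √2 := Real.lt_sqrt_of_sq_lt (by norm_num)
  have h2 : √2 < (1.4143 : ℝ) := (Real.sqrt_lt' (by norm_num)).2 (by norm_num)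
  constructor
  · have : (353 / 1000 : ℝ) < 1 / (2 * √2) := by
      rw [lt_div_iff₀ (by positivity)]
      linarith
    linarith
  · have : 1 / (2 * √2) < (354 / 1000 : ℝ) := by
      rw [div_lt_iff₀ (by positivity)]
      linarith
    linarith

lemma qubit_const_bounds {l : ℝ} (hl : 853 / 1000 < l) (hl' : l < 854 / 1000) :
    0 < (l + 1 / 100000) ^ (999 / 1000 : ℝ) * (1 - (l + 1 / 100000) ^ ((1 : ℝ) - 999 / 1000)) *
        Real.logb 2 ((l + 1 / 100000) / l) / (8 * Real.logb 2 (1 / (1 / 100000 : ℝ))) ∧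
      (l + 1 / 100000) ^ (999 / 1000 : ℝ) * (1 - (l + 1 / 100000) ^ ((1 : ℝ) - 999 / 1000)) *
        Real.logb 2 ((l + 1 / 100000) / l) / (8 * Real.logb 2 (1 / (1 / 100000 : ℝ))) ≤
        3 / 10 ^ 11 := by
  have hl0 : 0 < l := by linarith
  obtain ⟨lam, hlam⟩ : ∃ lam, lam = l + 1 / 100000 := ⟨_, rfl⟩
  rw [← hlam]
  have hlam0 : 853 / 1000 < lam := by linarith
  have hlam1 : lam < 1 := by linarith
  have hpos : 0 < lam := by linarith
  have hlog2 := Real.log_two_gt_d9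
  have ha0 : 0 < lam ^ (999 / 1000 : ℝ) := by positivity
  have ha1 : lam ^ (999 / 1000 : ℝ) ≤ 1 := Real.rpow_le_one hpos.le hlam1.le (by norm_num)
  have hb0 : 0 < 1 - lam ^ ((1 : ℝ) - 999 / 1000) :=
    sub_pos.2 (Real.rpow_lt_one hpos.le hlam1 (by norm_num))
  have hb1 : 1 - lam ^ ((1 : ℝ) - 999 / 1000) ≤ 173 / 10 ^ 6 := by
    have hlog : 1 - 1 / lam ≤ Real.log lam := by
      simpa using Real.one_sub_inv_le_log_of_pos hpos
    have hinv : 1 / lam ≤ 1173 / 1000 := by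
      rw [div_le_iff₀ hpos]
      linarith
    have hexp := Real.add_one_le_exp (Real.log lam * (1 - 999 / 1000))
    rw [Real.rpow_def_of_pos hpos]
    linarith
  have hratio : lam / l = 1 + 1 / 100000 / l := by
    rw [hlam]
    field_simp
  have hc0 : 0 < Real.logb 2 (lam / l) := by
    refine Real.logb_pos (by norm_num) ?_
    rw [hratio]
    have : 0 < 1 / 100000 / l := by positivity
    linarith
  have hc1 : Real.logb 2 (lam / l) ≤ 17 / 10 ^ 6 := by
    have hlog := Real.log_le_sub_one_of_pos (x := lam / l) (by positivity)
    have hsmall : 1 / 100000 / l ≤ 1173 / 10 ^ 8 := by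
      rw [div_le_iff₀ hl0]
      linarith
    rw [Real.logb, div_le_iff₀ (by linarith)]
    linarith
  have hd : 16 ≤ Real.logb 2 (1 / (1 / 100000 : ℝ)) := by
    rw [Real.le_logb_iff_rpow_le (by norm_num) (by norm_num)]
    norm_num
  refine ⟨by positivity, ?_⟩
  rw [div_le_iff₀ (by positivity)]
  calc lam ^ (999 / 1000 : ℝ) * (1 - lam ^ ((1 : ℝ) - 999 / 1000)) * Real.logb 2 (lam / l)
      ≤ 1 * (173 / 10 ^ 6) * (17 / 10 ^ 6) := by gcongr
    _ ≤ 3 / 10 ^ 11 * (8 * Real.logb 2 (1 / (1 / 100000 : ℝ))) := by linarith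

lemma sq_two_pow_le_of_lt {n q : ℕ} {K : ℝ} (hK : 0 < K)
    (hq : (q : ℝ) < (n : ℝ) / 2 + 1 / 2 * Real.logb 2 K) :
    ((2 : ℝ) ^ q) ^ 2 ≤ K * 2 ^ n := by
  have h : ((2 : ℝ) ^ q) ^ 2 = (2 : ℝ) ^ (2 * q : ℝ) := by
    rw [← pow_mul, ← Real.rpow_natCast]
    push_cast
    ring_nf
  rw [h]
  calc (2 : ℝ) ^ (2 * q : ℝ) ≤ 2 ^ (Real.logb 2 K + n) :=
        Real.rpow_le_rpow_of_exponent_le (by norm_num) (by linarith)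
    _ = K * 2 ^ n := by
        rw [Real.rpow_add (by norm_num), Real.rpow_logb (by norm_num) (by norm_num) hK,
          Real.rpow_natCast]

lemma ncard_attackable_bits_le {n a b c d : ℕ} (hn : 36 ≤ n) (hq : a + b = c + d)
    (hsmall : ((2 : ℝ) ^ (a + b)) ^ 2 ≤ 3 / 10 ^ 11 * 2 ^ n) :
    ((attackable n (Bits a) (Bits b) (Bits c) (Bits d)
        (1 / 2 + 1 / (2 * √2) + 12 / 100000 + 6 * (1 / 2) ^ 16)).ncard : ℝ) ≤
      2 ^ (2 ^ (2 * n)) * (2 : ℝ) ^ (-(5 * 2 ^ n + 1) : ℝ) := by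
  have hcard : ∀ i j : ℕ, Fintype.card (Bits i × Bits j) = 2 ^ (i + j) := fun i j => by
    simp [pow_add]
  refine (ncard_attackable_le n 16 (Bits a) (Bits b) (Bits c) (Bits d) (t := 12 / 100000)
    (by norm_num) (hcard a b) ((hcard c d).trans (by rw [hq]))).trans ?_
  rw [mul_left_comm]
  gcongr
  obtain ⟨M, hM⟩ : ∃ M : ℝ, M = 2 ^ n := ⟨_, rfl⟩
  have hM36 : (2 : ℝ) ^ 36 ≤ M := hM ▸ pow_le_pow_right₀ (by norm_num) hn
  have hexp : ∀ x : ℝ, 0 ≤ x → Real.exp (-x) ≤ (2 : ℝ) ^ (-x) := fun x hx => by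
    rw [Real.rpow_def_of_pos (by norm_num)]
    gcongr
    nlinarith [Real.log_two_lt_d9]
  calc (2 : ℝ) ^ ((16 + 3) * (4 * (2 ^ (a + b)) ^ 2 * (2 ^ n + 1))) *
        Real.exp (-(2 * (12 / 100000) ^ 2 * 2 ^ (2 * n)))
      ≤ (2 : ℝ) ^ ((16 + 3) * (4 * (2 ^ (a + b)) ^ 2 * (2 ^ n + 1)) : ℝ) *
        (2 : ℝ) ^ (-(2 * (12 / 100000) ^ 2 * 2 ^ (2 * n)) : ℝ) := by
        gcongr
        · rw [← Real.rpow_natCast]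
          push_cast
          norm_num
        · exact hexp _ (by positivity)
    _ = (2 : ℝ) ^ ((16 + 3) * (4 * (2 ^ (a + b)) ^ 2 * (2 ^ n + 1)) +
          -(2 * (12 / 100000) ^ 2 * 2 ^ (2 * n)) : ℝ) := (Real.rpow_add (by norm_num) _ _).symm
    _ ≤ (2 : ℝ) ^ (-(5 * 2 ^ n + 1) : ℝ) := by
        refine Real.rpow_le_rpow_of_exponent_le (by norm_num) ?_
        rw [mul_comm 2 n, pow_mul, ← hM]
        rw [← hM] at hsmall
        have h1 : ((2 : ℝ) ^ (a + b)) ^ 2 * (M + 1) ≤ 3 / 10 ^ 11 * M * (M + 1) := by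
          gcongr
        nlinarith

lemma iUnion_attackable_ncard_le {n : ℕ} (hn : 36 ≤ n)
    (D : (Fin (n + 1) × Fin (n + 1)) × Fin (n + 1) × Fin (n + 1) →
      Set (Bits n × Bits n → Bits 1))
    (hD : ∀ i, ((D i).ncard : ℝ) ≤ 2 ^ (2 ^ (2 * n)) * (2 : ℝ) ^ (-(5 * 2 ^ n + 1) : ℝ)) :
    (((⋃ i, D i).ncard : ℕ) : ℝ) ≤ 2 ^ (2 ^ (2 * n)) * (2 : ℝ) ^ (-(2 : ℝ) ^ n) / 2 := by
  have h : (((⋃ i, D i).ncard : ℕ) : ℝ) ≤ ∑ i, ((D i).ncard : ℝ) := by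
    exact_mod_cast Set.ncard_iUnion_le_of_fintype D
  have hn1 : ((n : ℝ) + 1) ≤ 2 ^ n := by exact_mod_cast Nat.lt_two_pow_self
  have hn2 : (n : ℝ) ≤ 2 ^ n := by linarith
  have hindex : ((n : ℝ) + 1) ^ 4 ≤ (2 : ℝ) ^ (4 * 2 ^ n : ℝ) :=
    calc ((n : ℝ) + 1) ^ 4 ≤ (2 ^ n) ^ 4 := by gcongr
      _ = (2 : ℝ) ^ (4 * n : ℝ) := by
          rw [← pow_mul, ← Real.rpow_natCast]
          push_cast
          ring_nf
      _ ≤ (2 : ℝ) ^ (4 * 2 ^ n : ℝ) := Real.rpow_le_rpow_of_exponent_le (by norm_num) (by linarith)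
  calc (((⋃ i, D i).ncard : ℕ) : ℝ)
      ≤ ∑ _i : (Fin (n + 1) × Fin (n + 1)) × Fin (n + 1) × Fin (n + 1),
          2 ^ (2 ^ (2 * n)) * (2 : ℝ) ^ (-(5 * 2 ^ n + 1) : ℝ) :=
        h.trans (Finset.sum_le_sum fun i _ => hD i)
    _ = ((n : ℝ) + 1) ^ 4 * (2 ^ (2 ^ (2 * n)) * (2 : ℝ) ^ (-(5 * 2 ^ n + 1) : ℝ)) := by
        simp only [Finset.sum_const, Finset.card_univ, Fintype.card_prod, Fintype.card_fin,
          nsmul_eq_mul]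
        push_cast
        ring
    _ ≤ (2 : ℝ) ^ (4 * 2 ^ n : ℝ) *
          (2 ^ (2 ^ (2 * n)) * (2 : ℝ) ^ (-(5 * 2 ^ n + 1) : ℝ)) := by gcongr
    _ = 2 ^ (2 ^ (2 * n)) * (2 : ℝ) ^ (4 * 2 ^ n + -(5 * 2 ^ n + 1) : ℝ) := by
        rw [Real.rpow_add (by norm_num)]
        ring
    _ = 2 ^ (2 ^ (2 * n)) * (2 : ℝ) ^ (-(2 : ℝ) ^ n) / 2 := by
        rw [show (4 * 2 ^ n + -(5 * 2 ^ n + 1) : ℝ) = -(2 : ℝ) ^ n - 1 by ring,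
          Real.rpow_sub_one (by norm_num), mul_div_assoc]

end Soundness

/-- single-round soundness `≈ 0.8539` of `QPV_BB84^f` (case `m = 1`,
`γ = 0`, `Δ = 10⁻⁵`, `c = 0.999`) against attackers pre-sharing `q < n/2 - O(1)` qubits,
for a uniformly random `f ∈ F*_ε`. -/
theorem stmt11 (n : ℕ) (hn : 36 ≤ n) (ε : ℝ) (hε0 : 0 < ε) (hε : ε ≤ 1 / 4)
    (hregime : Real.sqrt (3 * Real.log (2 / ε)) * (2 : ℝ) ^ (-(n : ℝ) + 1 / 2) < 1 / 4) :
    (1 - (2 : ℝ) ^ (-(2 : ℝ) ^ ((n : ℝ) -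
          (999 / 1000 : ℝ) *
            Real.logb 2 (1 / (1 / 2 + 1 / (2 * Real.sqrt 2) + 1 / 100000))))) *
        ((Fstar n 1 ε).ncard : ℝ) ≤
      (({f ∈ Fstar n 1 ε |
          ∀ q : ℕ,
            (q : ℝ) < (n : ℝ) / 2 + (1 / 2) *
                Real.logb 2
                  ((1 / 2 + 1 / (2 * Real.sqrt 2) + 1 / 100000) ^ ((999 / 1000 : ℝ)) *
                    (1 - (1 / 2 + 1 / (2 * Real.sqrt 2) + 1 / 100000) ^
                      ((1 : ℝ) - 999 / 1000)) *
                    Real.logb 2 ((1 / 2 + 1 / (2 * Real.sqrt 2) + 1 / 100000) /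
                      (1 / 2 + 1 / (2 * Real.sqrt 2))) /
                  (8 * Real.logb 2 (1 / (1 / 100000 : ℝ)))) →
              ∀ S : BB84Strategy n 1 q,
                S.win 0 f ≤
                  (1 / 2 + 1 / (2 * Real.sqrt 2) + 1 / 100000) ^ ((999 / 1000 : ℝ)) *
                      (1 + 3 * Real.sqrt (6 * Real.log 2) * (2 : ℝ) ^ (-(n : ℝ))) +
                    21 / 100000}).ncard : ℝ) := by
  obtain ⟨l, hl⟩ : ∃ l : ℝ, l = 1 / 2 + 1 / (2 * √2) := ⟨_, rfl⟩
  rw [← hl]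
  obtain ⟨hl0, hl1⟩ := bb84_const_bounds
  rw [← hl] at hl0 hl1
  obtain ⟨hK0, hK1⟩ := qubit_const_bounds hl0 hl1
  set K := (l + 1 / 100000) ^ (999 / 1000 : ℝ) * (1 - (l + 1 / 100000) ^ ((1 : ℝ) - 999 / 1000)) *
    Real.logb 2 ((l + 1 / 100000) / l) / (8 * Real.logb 2 (1 / (1 / 100000 : ℝ))) with hK
  set w := (l + 1 / 100000) ^ (999 / 1000 : ℝ) *
    (1 + 3 * √(6 * Real.log 2) * (2 : ℝ) ^ (-(n : ℝ))) + 21 / 100000 with hw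
  have hlw : l + 12 / 100000 + 6 * (1 / 2) ^ 16 ≤ w := by
    have h1 : l + 1 / 100000 ≤ (l + 1 / 100000) ^ (999 / 1000 : ℝ) :=
      Real.self_le_rpow_of_le_one (by linarith) (by linarith) (by norm_num)
    have h2 : (l + 1 / 100000) ^ (999 / 1000 : ℝ) ≤ (l + 1 / 100000) ^ (999 / 1000 : ℝ) *
        (1 + 3 * √(6 * Real.log 2) * (2 : ℝ) ^ (-(n : ℝ))) :=
      le_mul_of_one_le_right (by linarith) (le_add_of_nonneg_right (by positivity))
    linarith
  set G := {f ∈ Fstar n 1 ε | ∀ q : ℕ, (q : ℝ) < (n : ℝ) / 2 + (1 / 2) * Real.logb 2 K →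
    ∀ S : BB84Strategy n 1 q, S.win 0 f ≤ w} with hG
  classical
  set D : (Fin (n + 1) × Fin (n + 1)) × Fin (n + 1) × Fin (n + 1) →
      Set (Bits n × Bits n → Bits 1) := fun i =>
    if (i.1.1 + i.1.2 : ℕ) = i.2.1 + i.2.2 ∧
        ((2 : ℝ) ^ (i.1.1 + i.1.2 : ℕ)) ^ 2 ≤ 3 / 10 ^ 11 * 2 ^ n then
      attackable n (Bits i.1.1) (Bits i.1.2) (Bits i.2.1) (Bits i.2.2)
        (1 / 2 + 1 / (2 * √2) + 12 / 100000 + 6 * (1 / 2) ^ 16)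
    else ∅ with hD
  have hDcard := iUnion_attackable_ncard_le hn D fun i => by
    simp only [hD]
    split_ifs with h
    · exact ncard_attackable_bits_le hn h.1 h.2
    · rw [Set.ncard_empty, Nat.cast_zero]
      positivity
  have hcover : Fstar n 1 ε ⊆ G ∪ ⋃ i, D i := by
    intro f hf
    by_cases hfG : f ∈ G
    · exact Or.inl hfG
    refine Or.inr ?_
    simp only [hG, Set.mem_sep_iff, hf, true_and, not_forall, not_le] at hfG
    obtain ⟨q, hq, S, hS⟩ := hfG
    have hsq : ((2 : ℝ) ^ q) ^ 2 ≤ 3 / 10 ^ 11 * 2 ^ n :=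
      (sq_two_pow_le_of_lt hK0 hq).trans (by gcongr)
    have hqn : q ≤ n := by
      have h1 : (2 : ℝ) ^ q ≤ (2 ^ q) ^ 2 :=
        le_self_pow₀ (one_le_pow₀ (by norm_num)) (by norm_num)
      have h2 : (3 / 10 ^ 11 : ℝ) * 2 ^ n ≤ 2 ^ n :=
        mul_le_of_le_one_left (by positivity) (by norm_num)
      exact (pow_le_pow_iff_right₀ (by norm_num : (1 : ℝ) < 2)).1 (h1.trans (hsq.trans h2))
    have hA := S.hqA
    have hB := S.hqB
    refine Set.mem_iUnion.2 ⟨((⟨S.qAk, by lia⟩, ⟨S.qAc, by lia⟩), ⟨S.qBk, by lia⟩,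
      ⟨S.qBc, by lia⟩), ?_⟩
    simp only [hD, hA, hB, hsq, true_and, if_true]
    exact S.mem_attackable ((hl ▸ hlw).trans hS.le)
  have hcount : ((Fstar n 1 ε).ncard : ℝ) ≤ G.ncard + ((⋃ i, D i).ncard : ℕ) := by
    exact_mod_cast (Set.ncard_le_ncard hcover (Set.toFinite _)).trans (Set.ncard_union_le _ _)
  have hexponent : (2 : ℝ) ^ (-(2 : ℝ) ^ n) ≤ (2 : ℝ) ^ (-(2 : ℝ) ^ ((n : ℝ) -
      (999 / 1000 : ℝ) * Real.logb 2 (1 / (l + 1 / 100000)))) := by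
    have hlogb : 0 ≤ Real.logb 2 (1 / (l + 1 / 100000)) :=
      Real.logb_nonneg (by norm_num) ((one_le_div (by linarith)).2 (by linarith))
    refine Real.rpow_le_rpow_of_exponent_le (by norm_num) (neg_le_neg ?_)
    rw [← Real.rpow_natCast]
    exact Real.rpow_le_rpow_of_exponent_le (by norm_num) (by linarith)
  have hbad : (((⋃ i, D i).ncard : ℕ) : ℝ) ≤ (2 : ℝ) ^ (-(2 : ℝ) ^ ((n : ℝ) -
      (999 / 1000 : ℝ) * Real.logb 2 (1 / (l + 1 / 100000)))) * (Fstar n 1 ε).ncard :=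
    calc (((⋃ i, D i).ncard : ℕ) : ℝ)
        ≤ (2 : ℝ) ^ (-(2 : ℝ) ^ n) * (2 ^ (2 ^ (2 * n)) / 2) := hDcard.trans (by linarith)
      _ ≤ (2 : ℝ) ^ (-(2 : ℝ) ^ n) * (Fstar n 1 ε).ncard := by
          gcongr
          linarith [two_pow_le_two_mul_ncard_Fstar n hε0 hε]
      _ ≤ _ := by gcongr
  linarith
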